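/- There exist absolute constants c₁, c₂, C > 0 such that for every prime p, every multiplicative subgroup Γ of F_p^* with c₁ · p^{1/2} ≤ |Γ| ≤ c₂ · p^{3/4} and |Γ| ≥ 2, and every Γ-invariant set S ⊆ F_p^*, one has | E₃(S) − |S|^6 / p² | ≤ C · ( |S|⁴ |Γ|^{−1} + p |S|³ |Γ|^{−4/3} (log |Γ|)³ ). -/

import Mathlib

open Finset

/-- `(A ∘ A)(x)` = number of pairs `(a, a') ∈ A × A` with `a' - a = x`. -/
def convAA {p : ℕ} (A : Finset (ZMod p)) (x : ZMod p) : ℕ :=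
  (A.filter fun a => a + x ∈ A).card

/-- Third energy `E₃(A) = Σ_x (A ∘ A)(x)³`. -/
def energy3 {p : ℕ} [NeZero p] (A : Finset (ZMod p)) : ℕ :=
  ∑ x : ZMod p, (convAA A x) ^ 3

section Stepanov

open Polynomial

variable {F : Type*} [Field F]

/-- A nonzero polynomial of degree less than the characteristic vanishes at `1` to order less than
its number of monomials. -/
theorem eq_zero_of_X_sub_one_pow_dvd (p : ℕ) [CharP F p] (n : ℕ) :
    ∀ f : F[X], #f.support ≤ n → f.natDegree < p → (X - 1) ^ n ∣ f → f = 0 := by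
  induction n with
  | zero => intro f hf _ _; simpa using hf
  | succ n ih =>
    intro f hf hdeg hdvd
    by_contra hf0
    set k := f.natDegree with hk
    set g : F[X] := X * derivative f - C (k : F) * f with hg
    have hcoeff (m : ℕ) : g.coeff m = ((m : F) - k) * f.coeff m := by
      rw [hg, coeff_sub, coeff_C_mul]
      cases m with
      | zero => simp
      | succ m => rw [coeff_X_mul, coeff_derivative]; push_cast; ring
    have hsupp : g.support ⊆ f.support.erase k := by
      intro m hm
      rw [mem_support_iff, hcoeff] at hm
      rw [Finset.mem_erase, mem_support_iff]
      refine ⟨?_, right_ne_zero_of_mul hm⟩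
      rintro rfl
      simp at hm
    have hkmem : k ∈ f.support := natDegree_mem_support_of_nonzero hf0
    have hg0 : g = 0 := by
      refine ih g ?_ ?_ ?_
      · have := Finset.card_le_card hsupp
        rw [Finset.card_erase_of_mem hkmem] at this
        omega
      · refine lt_of_le_of_lt (natDegree_le_iff_coeff_eq_zero.mpr fun m hm => ?_) hdeg
        rw [hcoeff, coeff_eq_zero_of_natDegree_lt hm, mul_zero]
      · obtain ⟨q, hq⟩ := hdvd
        refine dvd_sub (Dvd.dvd.mul_left ?_ _) (Dvd.dvd.mul_left ?_ _)
        · rw [hq, derivative_mul]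
          refine dvd_add (Dvd.dvd.mul_right ?_ _) (Dvd.dvd.mul_right (pow_dvd_pow _ n.le_succ) _)
          rw [derivative_pow]
          exact Dvd.dvd.mul_right (Dvd.dvd.mul_left (by simp) _) _
        · exact (pow_dvd_pow _ n.le_succ).trans ⟨q, hq⟩
    have hf_monomial : f = C f.leadingCoeff * X ^ k := by
      ext m
      rw [coeff_C_mul_X_pow]
      split_ifs with h
      · rw [h, hk, leadingCoeff]
      · by_cases hm : k < m
        · exact coeff_eq_zero_of_natDegree_lt hm
        · have h1 := hcoeff m
          rw [hg0, coeff_zero, zero_eq_mul] at h1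
          refine h1.resolve_left fun h2 => h ?_
          exact CharP.natCast_injOn_Iio F p (Set.mem_Iio.mpr (by omega)) (Set.mem_Iio.mpr hdeg)
            (sub_eq_zero.mp h2)
    have heval : f.eval 1 = 0 := by
      obtain ⟨q, hq⟩ := hdvd
      rw [hq]; simp
    rw [hf_monomial] at heval
    simp at heval
    exact hf0 heval

/-- The derivation `x (1 - x) d/dx`. -/
noncomputable def theta (f : F[X]) : F[X] := X * (1 - X) * derivative f

/-- If `θⁿ f` vanishes at `x ≠ 0, 1` for all `n < D`, then `f` vanishes at `x` to order `D`. -/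
theorem X_sub_C_pow_dvd_of_theta (p : ℕ) [CharP F p] {x : F} (hx0 : x ≠ 0)
    (hx1 : x ≠ 1) (D : ℕ) : D ≤ p → ∀ f : F[X], (∀ n < D, (theta^[n] f).eval x = 0) →
      (X - C x) ^ D ∣ f := by
  induction D with
  | zero => intro _ f _; simp
  | succ D ih =>
    intro hD f hf
    obtain ⟨g, hg⟩ := ih (by omega) f fun n hn => hf n (by omega)
    have hroot {q : F[X]} (h : q.eval x = 0) : X - C x ∣ q := dvd_iff_isRoot.mpr h
    cases D with
    | zero => simpa using hroot (hf 0 (by omega))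
    | succ D =>
      have h1 : (X - C x) ^ (D + 1) ∣ theta f :=
        ih (by omega) (theta f) fun n hn => by
          simpa [Function.iterate_succ_apply] using hf (n + 1) (by omega)
      have hirr : Prime (X - C x) := prime_X_sub_C x
      have h2 : (X - C x) ^ (D + 1) ∣ derivative f := by
        refine hirr.pow_dvd_of_dvd_mul_left (a := X * (1 - X)) _ ?_ h1
        rw [dvd_iff_isRoot]
        simp [sub_eq_zero, hx0, Ne.symm hx1]
      have h3 : X - C x ∣ C ((D + 1 : ℕ) : F) * g := by
        rw [hg, derivative_mul, derivative_pow,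
          dvd_add_left (Dvd.dvd.mul_right dvd_rfl _)] at h2
        simp only [Nat.add_sub_cancel, derivative_sub, derivative_X, derivative_C, sub_zero,
          mul_one] at h2
        rw [pow_succ, mul_comm (C _), mul_assoc] at h2
        exact (mul_dvd_mul_iff_left (pow_ne_zero _ hirr.ne_zero)).mp h2
      have hne : ((D + 1 : ℕ) : F) ≠ 0 := by
        rw [Ne, CharP.cast_eq_zero_iff F p]
        exact fun h => by have := Nat.le_of_dvd (by omega) h; omega
      obtain ⟨q, rfl⟩ := (IsUnit.dvd_mul_left (isUnit_C.mpr hne.isUnit)).mp h3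
      exact ⟨q, by rw [hg]; ring⟩

/-- The conjugate of `x (1 - x) d/dx` by multiplication by `x ^ m (1 - x) ^ n`. -/
noncomputable def twist (m n : ℕ) : F[X] →ₗ[F] F[X] :=
  LinearMap.mulLeft F (C (m : F) * (1 - X) - C (n : F) * X) +
    LinearMap.mulLeft F (X * (1 - X)) ∘ₗ derivative

theorem twist_apply (m n : ℕ) (P : F[X]) : twist m n P =
    (C (m : F) * (1 - X) - C (n : F) * X) * P + X * (1 - X) * derivative P := rfl

theorem mul_derivative_pow_self (q : F[X]) (m : ℕ) :
    q * derivative (q ^ m) = C (m : F) * q ^ m * derivative q := by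
  cases m with
  | zero => simp
  | succ m => rw [derivative_pow]; simp only [Nat.add_sub_cancel]; ring

theorem theta_mul_twist (m n : ℕ) (P : F[X]) :
    theta (X ^ m * (1 - X) ^ n * P) = X ^ m * (1 - X) ^ n * twist m n P := by
  have h1 := mul_derivative_pow_self (X : F[X]) m
  have h2 := mul_derivative_pow_self (1 - X : F[X]) n
  simp only [derivative_X, derivative_sub, derivative_one] at h1 h2
  rw [theta, twist_apply, derivative_mul, derivative_mul]
  linear_combination (1 - X) * (1 - X) ^ n * P * h1 + X * X ^ m * P * h2

theorem theta_sum {ι : Type*} (s : Finset ι) (f : ι → F[X]) :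
    theta (∑ i ∈ s, f i) = ∑ i ∈ s, theta (f i) := by
  simp [theta, Finset.mul_sum]

theorem theta_iterate_sum {ι : Type*} (s : Finset ι) (m n : ι → ℕ) (P : ι → F[X]) (k : ℕ) :
    theta^[k] (∑ i ∈ s, X ^ m i * (1 - X) ^ n i * P i) =
      ∑ i ∈ s, X ^ m i * (1 - X) ^ n i * ((twist (m i) (n i)) ^ k) (P i) := by
  induction k with
  | zero => simp
  | succ k ih =>
    rw [Function.iterate_succ_apply', ih, theta_sum]
    refine Finset.sum_congr rfl fun i _ => ?_
    rw [theta_mul_twist, pow_succ', Module.End.mul_apply]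

theorem degree_twist_lt {m n A : ℕ} {P : F[X]} (hP : P.degree < A) :
    (twist m n P).degree < (A + 1 : ℕ) := by
  rw [degree_lt_iff_coeff_zero] at hP ⊢
  intro k hk
  obtain ⟨k, rfl⟩ : ∃ l, k = l + 1 := ⟨k - 1, by omega⟩
  have h : twist m n P = C (m : F) * P - C (m : F) * (X * P) - C (n : F) * (X * P)
      + X * derivative P - X * (X * derivative P) := by
    rw [twist_apply]; ring
  rw [h]
  cases k with
  | zero =>
    have : A = 0 := by omega
    subst this
    simp [coeff_derivative, coeff_X_mul, hP]
  | succ k =>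
    simp only [coeff_sub, coeff_add, coeff_C_mul, coeff_X_mul, coeff_derivative]
    rw [hP (k + 1) (by omega), hP (k + 1 + 1) (by omega)]
    simp

theorem degree_twist_pow_lt {m n A : ℕ} {P : F[X]} (hP : P.degree < A) (k : ℕ) :
    ((twist m n ^ k) P).degree < (A + k : ℕ) := by
  induction k with
  | zero => simpa using hP
  | succ k ih =>
    rw [pow_succ', Module.End.mul_apply]
    exact degree_twist_lt ih

/-- Siegel-type step: auxiliary polynomials exist as soon as the unknowns outnumber the
equations. -/
theorem exists_auxiliary {ι : Type*} [Fintype ι] (w : ι → F) (m n : ι → ℕ) {A D : ℕ}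
    (hAD : D * (A + D) < Fintype.card ι * A) :
    ∃ P : ι → F[X], P ≠ 0 ∧ (∀ i, (P i).degree < A) ∧
      ∀ k < D, ∑ i, C (w i) * ((twist (m i) (n i)) ^ k) (P i) = 0 := by
  classical
  let L : (ι → degreeLT F A) →ₗ[F] (Fin D → Fin (A + D) → F) :=
    LinearMap.pi fun k => LinearMap.pi fun j => ∑ i, w i •
      (lcoeff F (j : ℕ) ∘ₗ ((twist (m i) (n i)) ^ (k : ℕ)) ∘ₗ (degreeLT F A).subtype ∘ₗ
        (LinearMap.proj i : (ι → degreeLT F A) →ₗ[F] degreeLT F A))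
  have : FiniteDimensional F (degreeLT F A) := (degreeLTEquiv F A).symm.finiteDimensional
  have hker : LinearMap.ker L ≠ ⊥ := by
    refine LinearMap.ker_ne_bot_of_finrank_lt ?_
    simp [Module.finrank_pi_fintype, (degreeLTEquiv F A).finrank_eq]
    exact hAD
  obtain ⟨P, hP, hP0⟩ := (Submodule.ne_bot_iff _).mp hker
  have hdeg (i : ι) : (P i : F[X]).degree < A := mem_degreeLT.mp (P i).2
  refine ⟨fun i => P i, fun h => hP0 ?_, hdeg, fun k hk => ?_⟩
  · ext1 i
    exact Subtype.ext (congrFun h i)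
  · ext j
    simp only [finsetSum_coeff, coeff_C_mul, coeff_zero]
    by_cases hj : j < A + D
    · have := congrFun (congrFun (LinearMap.mem_ker.mp hP) ⟨k, hk⟩) ⟨j, hj⟩
      simpa [L] using this
    · refine Finset.sum_eq_zero fun i _ => ?_
      rw [coeff_eq_zero_of_degree_lt, mul_zero]
      refine (degree_twist_pow_lt (hdeg i) k).trans_le ?_
      exact_mod_cast (by omega : A + k ≤ j)

theorem coeff_block {t A B : ℕ} (hAt : A ≤ t) {Q : Fin B → F[X]} (hQ : ∀ b, (Q b).degree < A)
    (b : Fin B) {a : ℕ} (ha : a < t) :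
    (∑ b : Fin B, X ^ (t * (b : ℕ)) * Q b).coeff (t * b + a) = (Q b).coeff a := by
  rw [finsetSum_coeff, Finset.sum_eq_single b]
  · rw [coeff_X_pow_mul', if_pos (by omega), Nat.add_sub_cancel_left]
  · intro c _ hc
    rw [coeff_X_pow_mul']
    split_ifs with h
    · have hcb : (c : ℕ) < b := by
        have h1 : t * (c : ℕ) < t * (b + 1) := by rw [mul_add]; omega
        have h2 := Nat.lt_of_mul_lt_mul_left h1
        have h3 : (c : ℕ) ≠ b := fun h => hc (Fin.ext h)
        omega
      have h4 : t * ((c : ℕ) + 1) ≤ t * b := Nat.mul_le_mul_left _ hcb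
      rw [mul_add] at h4
      refine coeff_eq_zero_of_degree_lt ((hQ c).trans_le ?_)
      exact_mod_cast (by omega : A ≤ t * (b : ℕ) + a - t * c)
    · rfl
  · simp

theorem eq_zero_of_block_eq_zero {t A B : ℕ} (hAt : A ≤ t) {Q : Fin B → F[X]}
    (hQ : ∀ b, (Q b).degree < A) (h : ∑ b : Fin B, X ^ (t * (b : ℕ)) * Q b = 0) (b : Fin B) :
    Q b = 0 := by
  ext a
  rw [coeff_zero]
  by_cases ha : a < t
  · rw [← coeff_block hAt hQ b ha, h, coeff_zero]
  · exact coeff_eq_zero_of_degree_lt ((hQ b).trans_le (by exact_mod_cast (by omega : A ≤ a)))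

theorem card_support_block_le {t A B : ℕ} {Q : Fin B → F[X]} (hQ : ∀ b, (Q b).degree < A) :
    #(∑ b : Fin B, X ^ (t * (b : ℕ)) * Q b).support ≤ A * B := by
  classical
  have hsub : (∑ b : Fin B, X ^ (t * (b : ℕ)) * Q b).support ⊆
      ((Finset.univ : Finset (Fin B)) ×ˢ Finset.range A).image fun q => t * (q.1 : ℕ) + q.2 := by
    intro k hk
    rw [mem_support_iff, finsetSum_coeff] at hk
    obtain ⟨b, -, hb⟩ := Finset.exists_ne_zero_of_sum_ne_zero hk
    rw [coeff_X_pow_mul'] at hb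
    split_ifs at hb with h
    · refine Finset.mem_image.mpr ⟨(b, k - t * b), ?_, by simp; omega⟩
      simp only [Finset.mem_product, Finset.mem_univ, true_and, Finset.mem_range]
      by_contra! hA
      exact hb (coeff_eq_zero_of_degree_lt ((hQ b).trans_le (by exact_mod_cast hA)))
    · exact absurd rfl hb
  refine (Finset.card_le_card hsub).trans (Finset.card_image_le.trans ?_)
  simp [mul_comm]

theorem natDegree_block_lt {t A B p : ℕ} (hp : A + t * B ≤ p) (hp0 : 0 < p) {Q : Fin B → F[X]}
    (hQ : ∀ b, (Q b).degree < A) : (∑ b : Fin B, X ^ (t * (b : ℕ)) * Q b).natDegree < p := by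
  rw [Nat.lt_iff_le_pred hp0, natDegree_le_iff_coeff_eq_zero]
  intro k hk
  rw [finsetSum_coeff]
  refine Finset.sum_eq_zero fun b _ => ?_
  rw [coeff_X_pow_mul']
  split_ifs with h
  · refine coeff_eq_zero_of_degree_lt ((hQ b).trans_le ?_)
    have : t * (b : ℕ) ≤ t * B := Nat.mul_le_mul_left _ b.2.le
    exact_mod_cast (by omega : A ≤ k - t * b)
  · rfl

/-- The functions `x ^ (a + t b) (1 - x) ^ (t c)` are linearly independent. -/
theorem eq_zero_of_sum_eq_zero (p : ℕ) [CharP F p] {t A B : ℕ} (hAt : A ≤ t) (hAB : A * B ≤ t)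
    (hp : A + t * B ≤ p) (hp0 : 0 < p) {P : Fin B × Fin B → F[X]} (hP : ∀ i, (P i).degree < A)
    (h : ∑ i, X ^ (t * (i.1 : ℕ)) * (1 - X) ^ (t * (i.2 : ℕ)) * P i = 0) : P = 0 := by
  classical
  let G (c : Fin B) : F[X] := ∑ b : Fin B, X ^ (t * (b : ℕ)) * P (b, c)
  have hsum : ∑ c : Fin B, (1 - X) ^ (t * (c : ℕ)) * G c = 0 := by
    rw [← h, Fintype.sum_prod_type_right]
    refine Finset.sum_congr rfl fun c _ => ?_
    rw [Finset.mul_sum]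
    exact Finset.sum_congr rfl fun b _ => by ring
  have hone : (1 - X : F[X]) ≠ 0 := by
    intro h0
    simpa using congrArg (eval 0) h0
  have hG (n : ℕ) : ∀ c : Fin B, (c : ℕ) = n → G c = 0 := by
    induction n using Nat.strong_induction_on with
    | _ n ih =>
      intro c hc
      have hdvd : (1 - X : F[X]) ^ (t * (c : ℕ)) * (1 - X) ^ t ∣ (1 - X) ^ (t * (c : ℕ)) * G c := by
        rw [← Finset.add_sum_erase _ _ (Finset.mem_univ c)] at hsum
        rw [eq_neg_of_add_eq_zero_left hsum, dvd_neg]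
        refine Finset.dvd_sum fun d hd => ?_
        have hdc : (d : ℕ) ≠ c := fun h => (Finset.mem_erase.mp hd).1 (Fin.ext h)
        by_cases hlt : (d : ℕ) < c
        · rw [ih d (hc ▸ hlt) d rfl, mul_zero]
          exact dvd_zero _
        · rw [← pow_add]
          refine Dvd.dvd.mul_right (pow_dvd_pow _ ?_) _
          rw [← Nat.mul_succ]
          exact Nat.mul_le_mul_left _ (by omega)
      have hdvd' : (1 - X : F[X]) ^ t ∣ G c :=
        (mul_dvd_mul_iff_left (pow_ne_zero _ hone)).mp hdvd
      refine eq_zero_of_X_sub_one_pow_dvd p t (G c)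
        ((card_support_block_le fun b => hP (b, c)).trans hAB)
        (natDegree_block_lt hp hp0 fun b => hP (b, c)) ?_
      rw [← neg_sub, neg_pow]
      exact (IsUnit.mul_left_dvd ((isUnit_neg_one).pow t)).mpr hdvd'
  funext ⟨b, c⟩
  exact eq_zero_of_block_eq_zero hAt (fun b => hP (b, c)) (hG c c rfl) b

/-- Stepanov's method for the equations `x ^ t = u`, `(1 - x) ^ t = v`, with free parameters. -/
theorem card_mul_le_of_pow_eq (p : ℕ) [CharP F p] {t A B D : ℕ} (hA : 0 < A) (hAt : A ≤ t)
    (hAB : A * B ≤ t) (hD : D * (A + D) < B * B * A) (hp : A + 2 * (t * B) ≤ p) (hDp : D ≤ p)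
    {u v : F} {s : Finset F}
    (hs : ∀ x ∈ s, x ≠ 0 ∧ x ≠ 1 ∧ x ^ t = u ∧ (1 - x) ^ t = v) :
    #s * D ≤ A + 2 * (t * B) := by
  obtain ⟨P, hP0, hdeg, hP⟩ := exists_auxiliary
    (fun i : Fin B × Fin B => u ^ (i.1 : ℕ) * v ^ (i.2 : ℕ))
    (fun i => t * (i.1 : ℕ)) (fun i => t * (i.2 : ℕ)) (A := A) (D := D) (by simpa using hD)
  set f : F[X] := ∑ i : Fin B × Fin B, X ^ (t * (i.1 : ℕ)) * (1 - X) ^ (t * (i.2 : ℕ)) * P i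
    with hf
  have hf0 : f ≠ 0 := fun h =>
    hP0 (eq_zero_of_sum_eq_zero p hAt hAB (by omega) (by omega) hdeg h)
  have hfdeg : f.natDegree ≤ A + 2 * (t * B) := by
    refine natDegree_sum_le_of_forall_le _ _ fun i _ => ?_
    have h1 : t * (i.1 : ℕ) ≤ t * B := Nat.mul_le_mul_left _ i.1.2.le
    have h2 : t * (i.2 : ℕ) ≤ t * B := Nat.mul_le_mul_left _ i.2.2.le
    have h3 : (P i).natDegree ≤ A :=
      natDegree_le_iff_degree_le.mpr (hdeg i).le
    have h4 : ((1 - X : F[X]) ^ (t * (i.2 : ℕ))).natDegree ≤ t * (i.2 : ℕ) * 1 :=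
      natDegree_pow_le_of_le _ (by compute_degree)
    have h5 : (X ^ (t * (i.1 : ℕ)) : F[X]).natDegree ≤ t * (i.1 : ℕ) := natDegree_X_pow_le _
    exact (natDegree_mul_le.trans (add_le_add natDegree_mul_le le_rfl)).trans (by omega)
  have hdvd : ∏ x ∈ s, (X - C x) ^ D ∣ f := by
    refine Finset.prod_dvd_of_coprime ?_ fun x hx => ?_
    · intro x _ y _ hxy
      exact (isCoprime_X_sub_C_of_isUnit_sub (sub_ne_zero.mpr hxy).isUnit).pow
    · obtain ⟨hx0, hx1, hu, hv⟩ := hs x hx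
      refine X_sub_C_pow_dvd_of_theta p hx0 hx1 D hDp f fun k hk => ?_
      rw [hf, theta_iterate_sum, eval_finsetSum]
      have := congrArg (eval x) (hP k hk)
      rw [eval_finsetSum, eval_zero] at this
      rw [← this]
      refine Finset.sum_congr rfl fun i _ => ?_
      simp [pow_mul, hu, hv]
  have := natDegree_le_of_dvd hdvd hf0
  rw [natDegree_prod_of_monic _ _ fun x _ => (monic_X_sub_C x).pow D] at this
  simp at this
  exact this.trans hfdeg

theorem exists_cube_root {t : ℕ} (ht : 8 ≤ t) : ∃ b, 2 ≤ b ∧ b ^ 3 ≤ t ∧ t < (b + 1) ^ 3 := by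
  have h2 : 2 ≤ Nat.findGreatest (fun b => b ^ 3 ≤ t) t :=
    Nat.le_findGreatest (by omega) (by norm_num; exact ht)
  refine ⟨_, h2, Nat.findGreatest_spec (P := fun b => b ^ 3 ≤ t) (m := 2) (by omega)
    (by norm_num; exact ht), ?_⟩
  by_contra! h
  have h1 := Nat.le_findGreatest (P := fun b => b ^ 3 ≤ t) (n := t)
    ((Nat.le_self_pow (by norm_num) _).trans h) h
  omega

/-- The Garcia–Voloch bound: `x ^ t = u`, `(1 - x) ^ t = v` has `O(t ^ (2 / 3))` solutions as long
as `t` is at most a small multiple of `p ^ (3 / 4)`. -/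
theorem card_pow_three_le_of_pow_eq (p : ℕ) [CharP F p] {t : ℕ} (ht : 0 < t)
    (htp : 27 * t ^ 4 ≤ p ^ 3) {u v : F} {s : Finset F}
    (hs : ∀ x ∈ s, x ≠ 0 ∧ x ≠ 1 ∧ x ^ t = u ∧ (1 - x) ^ t = v) :
    #s ^ 3 ≤ 27 ^ 3 * t ^ 2 := by
  classical
  rcases lt_or_ge t 8 with h8 | h8
  · have hle : #s ≤ t := by
      refine le_trans ?_ (card_nthRoots t u)
      refine (Finset.card_le_card fun x hx => ?_).trans (Multiset.toFinset_card_le _)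
      rw [Multiset.mem_toFinset, mem_nthRoots ht]
      exact (hs x hx).2.2.1
    calc #s ^ 3 ≤ t ^ 3 := Nat.pow_le_pow_left hle 3
      _ = t * t ^ 2 := by ring
      _ ≤ 27 ^ 3 * t ^ 2 := Nat.mul_le_mul_right _ (by omega)
  · obtain ⟨b, hb2, hbt, htb⟩ := exists_cube_root h8
    obtain ⟨A, hA1, hA2⟩ : ∃ A, 4 * A ≤ b ^ 2 ∧ b ^ 2 < 4 * A + 4 := ⟨b ^ 2 / 4, by omega, by omega⟩
    have hb4 : 4 ≤ b ^ 2 := Nat.pow_le_pow_left hb2 2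
    have hA0 : 0 < A := by omega
    have hbsq : b ^ 2 ≤ b ^ 3 := Nat.pow_le_pow_right (by omega) (by norm_num)
    have hbb : b ≤ b ^ 2 := Nat.le_self_pow (by norm_num) b
    have h3tb : 3 * (t * b) ≤ p := by
      refine (Nat.pow_le_pow_iff_left (n := 3) (by norm_num)).mp (le_trans ?_ htp)
      calc (3 * (t * b)) ^ 3 = 27 * t ^ 3 * b ^ 3 := by ring
        _ ≤ 27 * t ^ 3 * t := Nat.mul_le_mul_left _ hbt
        _ = 27 * t ^ 4 := by ring
    have htb' : t ≤ t * b := Nat.le_mul_of_pos_right t (by omega)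
    have key : #s * A ≤ A + 2 * (t * b) := by
      refine card_mul_le_of_pow_eq p (B := b) hA0 (by omega) ?_ ?_ (by omega) (by omega) hs
      · calc A * b ≤ b ^ 2 * b := Nat.mul_le_mul_right _ (by omega)
          _ = b ^ 3 := by ring
          _ ≤ t := hbt
      · nlinarith
    have h1 : #s * b ≤ 18 * t := by
      have h2 : #s * b * b ≤ 18 * t * b := by nlinarith
      exact Nat.le_of_mul_le_mul_right h2 (by omega)
    have h2 : #s ^ 3 * b ^ 3 ≤ 18 ^ 3 * t ^ 3 := by
      rw [← mul_pow, ← mul_pow]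
      exact Nat.pow_le_pow_left h1 3
    have h3 : 8 * t ≤ 27 * b ^ 3 := by
      have : (2 * (b + 1)) ^ 3 ≤ (3 * b) ^ 3 := Nat.pow_le_pow_left (by omega) 3
      rw [mul_pow, mul_pow] at this
      omega
    refine Nat.le_of_mul_le_mul_right (c := 8 * t) ?_ (by omega)
    calc #s ^ 3 * (8 * t) ≤ #s ^ 3 * (27 * b ^ 3) := Nat.mul_le_mul_left _ h3
      _ = 27 * (#s ^ 3 * b ^ 3) := by ring
      _ ≤ 27 * (18 ^ 3 * t ^ 3) := Nat.mul_le_mul_left _ h2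
      _ = 27 ^ 3 * t ^ 2 * (8 * t) := by ring

end Stepanov

section Subgroup

variable {F : Type*} [Field F] [DecidableEq F]

theorem sum_mul_left_of_invariant {M : Type*} [AddCommMonoid M] {S : Finset F} {γ : F}
    (hγ : γ ≠ 0) (hS : ∀ s ∈ S, s * γ ∈ S) (f : F → M) : ∑ s ∈ S, f (s * γ) = ∑ s ∈ S, f s := by
  have hinj : Function.Injective (· * γ) := mul_left_injective₀ hγ
  have himage : S.image (· * γ) = S :=
    Finset.eq_of_subset_of_card_le (Finset.image_subset_iff.mpr hS)
      (Finset.card_image_of_injective S hinj).ge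
  conv_rhs => rw [← himage]
  rw [Finset.sum_image hinj.injOn]

theorem pow_card_eq_one_of_mul_mem {Γ : Finset F} (h0 : (0 : F) ∉ Γ)
    (hmul : ∀ x ∈ Γ, ∀ y ∈ Γ, x * y ∈ Γ) {γ : F} (hγ : γ ∈ Γ) : γ ^ #Γ = 1 := by
  have hinj : Function.Injective (· * γ) := mul_left_injective₀ (ne_of_mem_of_not_mem hγ h0)
  have himage : Γ.image (· * γ) = Γ :=
    Finset.eq_of_subset_of_card_le (Finset.image_subset_iff.mpr fun x hx => hmul x hx γ hγ)
      (Finset.card_image_of_injective Γ hinj).ge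
  have hprod : ∏ x ∈ Γ, x * γ = ∏ x ∈ Γ, x := by
    conv_rhs => rw [← himage]
    rw [Finset.prod_image hinj.injOn]
  rw [Finset.prod_mul_distrib, Finset.prod_const] at hprod
  exact (mul_eq_left₀ (Finset.prod_ne_zero_iff.mpr fun x hx => ne_of_mem_of_not_mem hx h0)).mp hprod

/-- The Garcia–Voloch bound for the intersection of two translated cosets. -/
theorem card_inter_cosets_pow_three_le [Fintype F] (p : ℕ) [CharP F p] {Γ : Finset F}
    (h0 : (0 : F) ∉ Γ) (hne : Γ.Nonempty) (hmul : ∀ x ∈ Γ, ∀ y ∈ Γ, x * y ∈ Γ)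
    (hp : 27 * #Γ ^ 4 ≤ p ^ 3) {a : F} (ha : a ≠ 0) (u v : F) :
    #{b : F | (b ≠ 0 ∧ b ≠ -a) ∧ u / b ∈ Γ ∧ v / (-a - b) ∈ Γ} ^ 3 ≤ 27 ^ 3 * #Γ ^ 2 := by
  have hinj : Function.Injective fun b : F => -b / a := by
    intro x y hxy
    simpa [ha] using hxy
  rw [← Finset.card_image_of_injective _ hinj]
  refine card_pow_three_le_of_pow_eq p (u := (-1 / a) ^ #Γ * u ^ #Γ)
    (v := (-1 / a) ^ #Γ * v ^ #Γ) hne.card_pos hp fun x hx => ?_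
  obtain ⟨b, hb, rfl⟩ := Finset.mem_image.mp hx
  simp only [Finset.mem_filter, Finset.mem_univ, true_and] at hb
  obtain ⟨⟨hb0, hba⟩, hu, hv⟩ := hb
  have hab : -a - b ≠ 0 := fun h => hba (by linear_combination -h)
  have hroot {w c : F} (hc : c ≠ 0) (hw : w / c ∈ Γ) : c ^ #Γ = w ^ #Γ := by
    have := pow_card_eq_one_of_mul_mem h0 hmul hw
    rw [div_pow, div_eq_one_iff_eq (pow_ne_zero _ hc)] at this
    exact this.symm
  refine ⟨by simp [ha, hb0], fun h => hba ?_, ?_, ?_⟩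
  · rw [div_eq_one_iff_eq ha] at h
    rw [← h, neg_neg]
  · rw [← hroot hb0 hu, ← mul_pow]
    ring
  · rw [← hroot hab hv, ← mul_pow]
    congr 1
    field_simp
    ring

variable [Fintype F]

theorem sum_mul_eq_sum_ite {Γ : Finset F} {b : F} (hb : b ≠ 0) (h : F → ℝ) :
    ∑ γ ∈ Γ, h (γ * b) = ∑ u, if u / b ∈ Γ then h u else 0 := by
  rw [← Finset.sum_filter]
  refine Finset.sum_nbij' (· * b) (· / b) ?_ ?_ ?_ ?_ ?_ <;> simp [hb]

theorem card_mul_le_sum {Γ : Finset F} {h : F → ℝ} (hnonneg : ∀ x, 0 ≤ h x)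
    (hinv : ∀ γ ∈ Γ, ∀ x, h (γ * x) = h x) {x : F} (hx : x ≠ 0) : #Γ * h x ≤ ∑ y, h y := by
  calc #Γ * h x = ∑ γ ∈ Γ, h (γ * x) := by
        rw [Finset.sum_congr rfl fun γ hγ => hinv γ hγ x]; simp
    _ = ∑ u, if u / x ∈ Γ then h u else 0 := sum_mul_eq_sum_ite hx h
    _ ≤ ∑ y, h y := Finset.sum_le_sum fun y _ => by split_ifs <;> simp [hnonneg]

/-- Off-diagonal correlations of a `Γ`-invariant function are controlled by intersections of
cosets of `Γ`. -/
theorem card_sq_mul_sum_mul_le {Γ : Finset F} {h : F → ℝ} (hnonneg : ∀ x, 0 ≤ h x)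
    (hinv : ∀ γ ∈ Γ, ∀ x, h (γ * x) = h x) {a : F} {N : ℝ}
    (hN : ∀ u v : F, #{b : F | (b ≠ 0 ∧ b ≠ -a) ∧ u / b ∈ Γ ∧ v / (-a - b) ∈ Γ} ≤ N) :
    (#Γ : ℝ) ^ 2 * ∑ b with b ≠ 0 ∧ b ≠ -a, h b * h (-a - b) ≤ N * (∑ x, h x) ^ 2 := by
  have hmean {x : F} (hx : x ≠ 0) : #Γ * h x = ∑ u, if u / x ∈ Γ then h u else 0 := by
    rw [← sum_mul_eq_sum_ite hx, Finset.sum_congr rfl fun γ hγ => hinv γ hγ x]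
    simp
  calc (#Γ : ℝ) ^ 2 * ∑ b with b ≠ 0 ∧ b ≠ -a, h b * h (-a - b)
      = ∑ b with b ≠ 0 ∧ b ≠ -a, ∑ u, ∑ v,
          if u / b ∈ Γ ∧ v / (-a - b) ∈ Γ then h u * h v else 0 := by
        rw [Finset.mul_sum]
        refine Finset.sum_congr rfl fun b hb => ?_
        obtain ⟨hb0, hba⟩ := (Finset.mem_filter.mp hb).2
        have hab : -a - b ≠ 0 := fun h => hba (by linear_combination -h)
        rw [show (#Γ : ℝ) ^ 2 * (h b * h (-a - b)) = #Γ * h b * (#Γ * h (-a - b)) by ring,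
          hmean hb0, hmean hab, Finset.sum_mul_sum]
        refine Finset.sum_congr rfl fun u _ => Finset.sum_congr rfl fun v _ => ?_
        split_ifs <;> simp_all
    _ = ∑ u, ∑ v, #{b : F | (b ≠ 0 ∧ b ≠ -a) ∧ u / b ∈ Γ ∧ v / (-a - b) ∈ Γ} * (h u * h v) := by
        rw [Finset.sum_comm]
        refine Finset.sum_congr rfl fun u _ => ?_
        rw [Finset.sum_comm]
        refine Finset.sum_congr rfl fun v _ => ?_
        rw [← Finset.sum_filter, Finset.filter_filter, Finset.sum_const, nsmul_eq_mul]
    _ ≤ ∑ u, ∑ v, N * (h u * h v) := by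
        gcongr with u _ v _
        · exact mul_nonneg (hnonneg u) (hnonneg v)
        · exact hN u v
    _ = N * (∑ x, h x) ^ 2 := by
        rw [sq, Finset.sum_mul_sum, Finset.mul_sum]
        exact Finset.sum_congr rfl fun u _ => (Finset.mul_sum _ _ _).symm

theorem sum_triple_sub_le {Γ : Finset F} (hΓ : Γ.Nonempty) {h : F → ℝ} (hnonneg : ∀ x, 0 ≤ h x)
    (hinv : ∀ γ ∈ Γ, ∀ x, h (γ * x) = h x) {N : ℝ}
    (hN : ∀ a : F, a ≠ 0 → ∀ u v : F,
      #{b : F | (b ≠ 0 ∧ b ≠ -a) ∧ u / b ∈ Γ ∧ v / (-a - b) ∈ Γ} ≤ N) :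
    |∑ a, ∑ b, h a * h b * h (-a - b) - h 0 ^ 3| ≤
      3 * h 0 * (∑ x, h x) ^ 2 / #Γ + N * (∑ x, h x) ^ 3 / #Γ ^ 2 := by
  set T := ∑ x, h x
  have ht : (0 : ℝ) < #Γ := by exact_mod_cast hΓ.card_pos
  have hT0 : 0 ≤ T := Finset.sum_nonneg fun x _ => hnonneg x
  have hmax {x : F} (hx : x ≠ 0) : h x ≤ T / #Γ := by
    rw [le_div_iff₀ ht, mul_comm]
    exact card_mul_le_sum hnonneg hinv hx
  have hsub (s : Finset F) : ∑ x ∈ s, h x ≤ T :=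
    Finset.sum_le_univ_sum_of_nonneg hnonneg
  set W : F → ℝ := fun a => ∑ b, h b * h (-a - b) with hW
  have hW0 : W 0 = h 0 ^ 2 + ∑ b ∈ Finset.univ.erase 0, h b * h (-b) := by
    rw [hW]
    simp only
    rw [← Finset.add_sum_erase _ _ (Finset.mem_univ (0 : F))]
    simp [sq]
  have hdiag : ∑ b ∈ Finset.univ.erase 0, h b * h (-b) ≤ T * (T / #Γ) := by
    calc ∑ b ∈ Finset.univ.erase 0, h b * h (-b) ≤ ∑ b ∈ Finset.univ.erase 0, h b * (T / #Γ) := by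
          refine Finset.sum_le_sum fun b hb => mul_le_mul_of_nonneg_left ?_ (hnonneg b)
          exact hmax (neg_ne_zero.mpr (Finset.ne_of_mem_erase hb))
      _ = (∑ b ∈ Finset.univ.erase 0, h b) * (T / #Γ) := by rw [Finset.sum_mul]
      _ ≤ T * (T / #Γ) := mul_le_mul_of_nonneg_right (hsub _) (by positivity)
  have hWa {a : F} (ha : a ≠ 0) : W a ≤ 2 * h 0 * (T / #Γ) + N * T ^ 2 / #Γ ^ 2 := by
    have hrest : ∑ b with b ≠ 0 ∧ b ≠ -a, h b * h (-a - b) ≤ N * T ^ 2 / #Γ ^ 2 := by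
      rw [le_div_iff₀ (by positivity), mul_comm]
      exact card_sq_mul_sum_mul_le hnonneg hinv (hN a ha)
    have hfilter : (Finset.univ.filter fun b : F => b ≠ 0 ∧ b ≠ -a) =
        (Finset.univ.erase 0).erase (-a) := by
      ext b; simp [and_comm]
    have hsplit : W a = h 0 * h (-a) + (h (-a) * h 0 +
        ∑ b with b ≠ 0 ∧ b ≠ -a, h b * h (-a - b)) := by
      rw [hfilter, hW]
      simp only
      rw [← Finset.add_sum_erase _ _ (Finset.mem_univ (0 : F)),
        ← Finset.add_sum_erase (Finset.univ.erase 0) _ (a := -a) (by simp [ha])]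
      simp
    have h1 := mul_le_mul_of_nonneg_left (hmax (neg_ne_zero.mpr ha)) (hnonneg 0)
    rw [hsplit]
    linarith
  have htotal : ∑ a, ∑ b, h a * h b * h (-a - b) =
      h 0 ^ 3 + (h 0 * ∑ b ∈ Finset.univ.erase 0, h b * h (-b) +
        ∑ a ∈ Finset.univ.erase 0, h a * W a) := by
    calc ∑ a, ∑ b, h a * h b * h (-a - b) = ∑ a, h a * W a := by
          simp only [hW, Finset.mul_sum, mul_assoc]
      _ = _ := by
          rw [← Finset.add_sum_erase _ _ (Finset.mem_univ (0 : F)), hW0]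
          ring
  have hoff : ∑ a ∈ Finset.univ.erase 0, h a * W a ≤
      T * (2 * h 0 * (T / #Γ) + N * T ^ 2 / #Γ ^ 2) := by
    have hN0 : 0 ≤ N := (Nat.cast_nonneg _).trans (hN 1 one_ne_zero 0 0)
    have h0 := hnonneg 0
    calc ∑ a ∈ Finset.univ.erase 0, h a * W a
        ≤ ∑ a ∈ Finset.univ.erase 0, h a * (2 * h 0 * (T / #Γ) + N * T ^ 2 / #Γ ^ 2) :=
          Finset.sum_le_sum fun a ha =>
            mul_le_mul_of_nonneg_left (hWa (Finset.ne_of_mem_erase ha)) (hnonneg a)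
      _ = (∑ a ∈ Finset.univ.erase 0, h a) * (2 * h 0 * (T / #Γ) + N * T ^ 2 / #Γ ^ 2) := by
          rw [Finset.sum_mul]
      _ ≤ _ := mul_le_mul_of_nonneg_right (hsub _) (by positivity)
  have hW_nonneg (a : F) : 0 ≤ W a :=
    Finset.sum_nonneg fun b _ => mul_nonneg (hnonneg _) (hnonneg _)
  have hdiag' := mul_le_mul_of_nonneg_left hdiag (hnonneg 0)
  rw [htotal, add_sub_cancel_left, abs_of_nonneg]
  · calc _ ≤ h 0 * (T * (T / #Γ)) + T * (2 * h 0 * (T / #Γ) + N * T ^ 2 / #Γ ^ 2) :=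
          add_le_add hdiag' hoff
      _ = _ := by ring
  · exact add_nonneg (mul_nonneg (hnonneg 0) (Finset.sum_nonneg fun b _ =>
      mul_nonneg (hnonneg _) (hnonneg _)))
      (Finset.sum_nonneg fun a _ => mul_nonneg (hnonneg _) (hW_nonneg a))

end Subgroup

section Fourier

open ZMod

variable {p : ℕ} [Fact p.Prime]

/-- The squared absolute value of the Fourier transform of the indicator function of `S`. -/
noncomputable def fourierSq (S : Finset (ZMod p)) (r : ZMod p) : ℝ :=
  ‖∑ s ∈ S, stdAddChar (s * r)‖ ^ 2

theorem fourierSq_nonneg (S : Finset (ZMod p)) (r : ZMod p) : 0 ≤ fourierSq S r := sq_nonneg _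

theorem fourierSq_zero (S : Finset (ZMod p)) : fourierSq S 0 = (#S : ℝ) ^ 2 := by
  simp [fourierSq]

theorem fourierSq_mul {S : Finset (ZMod p)} {γ : ZMod p} (hγ : γ ≠ 0) (hS : ∀ s ∈ S, s * γ ∈ S)
    (r : ZMod p) : fourierSq S (γ * r) = fourierSq S r := by
  rw [fourierSq, fourierSq,
    ← sum_mul_left_of_invariant hγ hS fun s => (stdAddChar (s * r) : ℂ)]
  simp only [mul_assoc]

theorem conj_stdAddChar (x : ZMod p) : (starRingEnd ℂ) (stdAddChar x) = stdAddChar (-x) := by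
  rw [AddChar.starComp_apply, AddChar.inv_apply]
  rw [ZMod.ringChar_zmod_n]
  exact (Fact.out : p.Prime).pos

theorem fourierSq_eq_sum (S : Finset (ZMod p)) (r : ZMod p) :
    (fourierSq S r : ℂ) = ∑ s ∈ S, ∑ s' ∈ S, stdAddChar (r * (s' - s)) := by
  rw [fourierSq, Complex.ofReal_pow, ← Complex.conj_mul', map_sum, Finset.sum_mul_sum]
  refine Finset.sum_congr rfl fun s _ => Finset.sum_congr rfl fun s' _ => ?_
  rw [conj_stdAddChar, ← AddChar.map_add_eq_mul]
  congr 1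
  ring

theorem sum_stdAddChar_mul (b : ZMod p) :
    ∑ x : ZMod p, stdAddChar (x * b) = if b = 0 then (p : ℂ) else 0 := by
  have := AddChar.sum_mulShift b (isPrimitive_stdAddChar p)
  simpa using this

theorem sum_fourierSq_mul_stdAddChar (S : Finset (ZMod p)) (x : ZMod p) :
    ∑ r, (fourierSq S r : ℂ) * stdAddChar (r * -x) = p * convAA S x := by
  calc ∑ r, (fourierSq S r : ℂ) * stdAddChar (r * -x)
      = ∑ r, ∑ s ∈ S, ∑ s' ∈ S, stdAddChar (r * (s' - s - x)) := by
        refine Finset.sum_congr rfl fun r _ => ?_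
        rw [fourierSq_eq_sum, Finset.sum_mul]
        refine Finset.sum_congr rfl fun s _ => ?_
        rw [Finset.sum_mul]
        refine Finset.sum_congr rfl fun s' _ => ?_
        rw [← AddChar.map_add_eq_mul]
        congr 1
        ring
    _ = ∑ s ∈ S, ∑ s' ∈ S, ∑ r, stdAddChar (r * (s' - s - x)) := by
        rw [Finset.sum_comm]
        exact Finset.sum_congr rfl fun s _ => Finset.sum_comm
    _ = ∑ s ∈ S, ∑ s' ∈ S, if s' = s + x then (p : ℂ) else 0 := by
        refine Finset.sum_congr rfl fun s _ => Finset.sum_congr rfl fun s' _ => ?_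
        rw [sum_stdAddChar_mul]
        congr 1
        rw [sub_sub, sub_eq_zero]
    _ = p * convAA S x := by
        simp only [Finset.sum_ite_eq', convAA, Finset.card_filter]
        push_cast
        rw [Finset.mul_sum]
        simp

theorem sum_fourierSq (S : Finset (ZMod p)) : ∑ r, fourierSq S r = p * #S := by
  have h := sum_fourierSq_mul_stdAddChar S 0
  simp [convAA] at h
  exact_mod_cast h

theorem sq_mul_energy3 (S : Finset (ZMod p)) : (p : ℝ) ^ 2 * energy3 S =
    ∑ a, ∑ b, fourierSq S a * fourierSq S b * fourierSq S (-a - b) := by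
  have hp : (p : ℂ) ≠ 0 := by exact_mod_cast (Fact.out : p.Prime).ne_zero
  have key : (p : ℂ) * ((p : ℂ) ^ 2 * energy3 S) =
      p * ∑ a, ∑ b, (fourierSq S a : ℂ) * fourierSq S b * fourierSq S (-a - b) := by
    calc (p : ℂ) * ((p : ℂ) ^ 2 * energy3 S) = ∑ x, (p * convAA S x : ℂ) ^ 3 := by
          rw [energy3]
          push_cast
          rw [← mul_assoc, Finset.mul_sum]
          exact Finset.sum_congr rfl fun x _ => by ring
      _ = ∑ x, ∑ a, ∑ b, ∑ c, (fourierSq S a : ℂ) * fourierSq S b * fourierSq S c *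
            stdAddChar (x * (-a - b - c)) := by
          refine Finset.sum_congr rfl fun x _ => ?_
          rw [← sum_fourierSq_mul_stdAddChar, pow_succ, sq, Finset.sum_mul_sum, Finset.sum_mul]
          refine Finset.sum_congr rfl fun a _ => ?_
          rw [Finset.sum_mul_sum]
          refine Finset.sum_congr rfl fun b _ => Finset.sum_congr rfl fun c _ => ?_
          rw [show x * (-a - b - c) = a * -x + b * -x + c * -x by ring, AddChar.map_add_eq_mul,
            AddChar.map_add_eq_mul]
          ring
      _ = ∑ a, ∑ b, ∑ c, (fourierSq S a : ℂ) * fourierSq S b * fourierSq S c *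
            if -a - b = c then (p : ℂ) else 0 := by
          rw [Finset.sum_comm]
          refine Finset.sum_congr rfl fun a _ => ?_
          rw [Finset.sum_comm]
          refine Finset.sum_congr rfl fun b _ => ?_
          rw [Finset.sum_comm]
          refine Finset.sum_congr rfl fun c _ => ?_
          rw [← Finset.mul_sum, sum_stdAddChar_mul]
          simp only [sub_eq_zero]
      _ = _ := by
          simp only [mul_ite, mul_zero, Finset.sum_ite_eq, Finset.mem_univ, if_true,
            Finset.mul_sum]
          exact Finset.sum_congr rfl fun a _ => Finset.sum_congr rfl fun b _ => by ring
  have := mul_left_cancel₀ hp key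
  exact_mod_cast this

/-- The third energy of a `Γ`-invariant set, with a bound free of logarithms. -/
theorem abs_energy3_sub_le {Γ S : Finset (ZMod p)} (h0 : (0 : ZMod p) ∉ Γ) (hΓ : Γ.Nonempty)
    (hmul : ∀ x ∈ Γ, ∀ y ∈ Γ, x * y ∈ Γ) (hp : 27 * #Γ ^ 4 ≤ p ^ 3)
    (hS : ∀ s ∈ S, ∀ γ ∈ Γ, s * γ ∈ S) :
    |(energy3 S : ℝ) - (#S : ℝ) ^ 6 / (p : ℝ) ^ 2| ≤
      3 * ((#S : ℝ) ^ 4 * (#Γ : ℝ) ^ (-(1 : ℝ))) +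
        27 * (p * (#S : ℝ) ^ 3 * (#Γ : ℝ) ^ (-(4 : ℝ) / 3)) := by
  have ht : (0 : ℝ) < #Γ := by exact_mod_cast hΓ.card_pos
  have hp0 : (0 : ℝ) < p := by exact_mod_cast (Fact.out : p.Prime).pos
  have hN (a : ZMod p) (ha : a ≠ 0) (u v : ZMod p) :
      (#{b : ZMod p | (b ≠ 0 ∧ b ≠ -a) ∧ u / b ∈ Γ ∧ v / (-a - b) ∈ Γ} : ℝ) ≤
        27 * (#Γ : ℝ) ^ ((2 : ℝ) / 3) := by
    have h : ((#{b : ZMod p | (b ≠ 0 ∧ b ≠ -a) ∧ u / b ∈ Γ ∧ v / (-a - b) ∈ Γ} : ℕ) : ℝ) ^ 3 ≤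
        27 ^ 3 * (#Γ : ℝ) ^ 2 := by
      exact_mod_cast card_inter_cosets_pow_three_le p h0 hΓ hmul hp ha u v
    refine (pow_le_pow_iff_left₀ (by positivity) (by positivity) (n := 3) (by norm_num)).mp
      (h.trans_eq ?_)
    rw [mul_pow, ← Real.rpow_mul_natCast ht.le, ← Real.rpow_natCast _ 2]
    norm_num
  have hinv (γ : ZMod p) (hγ : γ ∈ Γ) (x : ZMod p) : fourierSq S (γ * x) = fourierSq S x :=
    fourierSq_mul (ne_of_mem_of_not_mem hγ h0) (fun s hs => hS s hs γ hγ) x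
  have key := sum_triple_sub_le hΓ (fourierSq_nonneg S) hinv hN
  rw [← sq_mul_energy3, sum_fourierSq, fourierSq_zero] at key
  have hpow : (#Γ : ℝ) ^ ((2 : ℝ) / 3) = (#Γ : ℝ) ^ (-(4 : ℝ) / 3) * (#Γ : ℝ) ^ 2 := by
    rw [← Real.rpow_natCast _ 2, ← Real.rpow_add ht]
    norm_num
  have hsub : (p : ℝ) ^ 2 * energy3 S - ((#S : ℝ) ^ 2) ^ 3 =
      (p : ℝ) ^ 2 * (energy3 S - (#S : ℝ) ^ 6 / (p : ℝ) ^ 2) := by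
    field_simp
  rw [hsub, abs_mul, abs_of_pos (by positivity), hpow] at key
  refine le_of_mul_le_mul_left (key.trans_eq ?_) (by positivity : (0 : ℝ) < (p : ℝ) ^ 2)
  rw [Real.rpow_neg_one]
  field_simp

end Fourier

/-- There exist absolute constants `c₁, c₂, C > 0` such that for every prime
`p`, every multiplicative subgroup `Γ ⊆ F_p^*` with `c₁ p^{1/2} ≤ |Γ| ≤ c₂ p^{3/4}` and
`|Γ| ≥ 2`, and every `Γ`-invariant set `S ⊆ F_p^*`, one has
`|E₃(S) − |S|⁶/p²| ≤ C (|S|⁴ |Γ|^{−1} + p |S|³ |Γ|^{−4/3} (log |Γ|)³)`. -/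
theorem stmt19 :
    ∃ c₁ c₂ C : ℝ, 0 < c₁ ∧ 0 < c₂ ∧ 0 < C ∧
      ∀ (p : ℕ) [Fact p.Prime], ∀ Γ S : Finset (ZMod p),
        (0 : ZMod p) ∉ Γ → (1 : ZMod p) ∈ Γ →
        (∀ x ∈ Γ, ∀ y ∈ Γ, x * y ∈ Γ) → (∀ x ∈ Γ, x⁻¹ ∈ Γ) →
        2 ≤ Γ.card →
        c₁ * (p : ℝ) ^ ((1 : ℝ) / 2) ≤ (Γ.card : ℝ) →
        (Γ.card : ℝ) ≤ c₂ * (p : ℝ) ^ ((3 : ℝ) / 4) →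
        (0 : ZMod p) ∉ S → (∀ s ∈ S, ∀ γ ∈ Γ, s * γ ∈ S) →
        |(energy3 S : ℝ) - (S.card : ℝ) ^ (6 : ℕ) / (p : ℝ) ^ (2 : ℕ)| ≤
          C * ((S.card : ℝ) ^ (4 : ℕ) * (Γ.card : ℝ) ^ (-(1 : ℝ)) +
            (p : ℝ) * (S.card : ℝ) ^ (3 : ℕ) * (Γ.card : ℝ) ^ (-(4 : ℝ) / 3) *
              (Real.log Γ.card) ^ (3 : ℕ)) := by
  refine ⟨1, 1 / 3, 108, one_pos, by norm_num, by norm_num, ?_⟩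
  intro p _ Γ S h0 h1 hmul _ hcard _ hle _ hS
  have hp0 : (0 : ℝ) ≤ p := Nat.cast_nonneg p
  have hp : 27 * #Γ ^ 4 ≤ p ^ 3 := by
    have h4 := pow_le_pow_left₀ (Nat.cast_nonneg _) hle 4
    rw [mul_pow, ← Real.rpow_mul_natCast hp0] at h4
    norm_num at h4
    have hp3 : (0 : ℝ) ≤ (p : ℝ) ^ 3 := by positivity
    have : (27 : ℝ) * (#Γ : ℝ) ^ 4 ≤ (p : ℝ) ^ 3 := by linarith
    exact_mod_cast this
  have hlog : (1 : ℝ) / 4 ≤ Real.log #Γ ^ 3 := by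
    have h2 : Real.log 2 ≤ Real.log #Γ :=
      Real.log_le_log (by norm_num) (by exact_mod_cast hcard)
    have h3 : (0.69 : ℝ) ≤ Real.log #Γ := by linarith [Real.log_two_gt_d9]
    calc (1 : ℝ) / 4 ≤ 0.69 ^ 3 := by norm_num
      _ ≤ Real.log #Γ ^ 3 := pow_le_pow_left₀ (by norm_num) h3 3
  have hmain := abs_energy3_sub_le h0 ⟨1, h1⟩ hmul hp hS
  have hX : 0 ≤ (#S : ℝ) ^ 4 * (#Γ : ℝ) ^ (-(1 : ℝ)) := by positivity
  have hY : 0 ≤ (p : ℝ) * (#S : ℝ) ^ 3 * (#Γ : ℝ) ^ (-(4 : ℝ) / 3) := by positivity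
  have hYlog := mul_le_mul_of_nonneg_left hlog hY
  linarith
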